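/- arXiv:2605.08423 — 3 statements merged into one kernel-verified Lean document; each statement's English description precedes it below -/
import Mathlib

section
/- Let I be a nonempty finite index set and z : I → ℝ. Define the softmax vector α : I → ℝ by α m = exp(z m) / (∑ j, exp(z j)). Then α lies in the probability simplex Δ(I), and for every a ∈ Δ(I) one has ∑ m, a m * z m + H(a) ≤ ∑ m, α m * z m + H(α), with equality if and only if a = α; that is, softmax(z) is the unique maximizer over Δ(I) of the entropy-regularized linear objective a ↦ ⟨a, z⟩ + H(a). -/
open InformationTheory in
/-- The generalized Kullback–Leibler integrand `q * klFun (p / q)` in expanded form. -/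
lemma mul_klFun_div {p q : ℝ} (hq : 0 < q) :
    q * klFun (p / q) = p * Real.log p - p * Real.log q + q - p := by
  rcases eq_or_ne p 0 with rfl | hp
  · simp [klFun_zero]
  · rw [klFun_apply, Real.log_div hp hq.ne']
    field_simp

open InformationTheory in
/-- The entropy-regularized linear objective at `a` is the log-partition function minus the
Kullback–Leibler divergence of `a` from the softmax distribution. -/
lemma sum_mul_add_entropy_eq_log_sum_exp_sub {I : Type*} [Fintype I] [Nonempty I]
    {z α a : I → ℝ} (hα : ∀ m, α m = Real.exp (z m) / ∑ j, Real.exp (z j))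
    (hα_sum : ∑ m, α m = 1) (ha_sum : ∑ m, a m = 1) :
    (∑ m, a m * z m) + (-∑ m, a m * Real.log (a m)) =
      Real.log (∑ j, Real.exp (z j)) - ∑ m, α m * klFun (a m / α m) := by
  have hZ : 0 < ∑ j, Real.exp (z j) :=
    Finset.sum_pos (fun _ _ => Real.exp_pos _) Finset.univ_nonempty
  have h_term (m : I) : α m * klFun (a m / α m) =
      a m * Real.log (a m) - a m * z m + a m * Real.log (∑ j, Real.exp (z j)) + α m - a m := by
    have h_pos : 0 < α m := hα m ▸ div_pos (Real.exp_pos _) hZ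
    have h_log : Real.log (α m) = z m - Real.log (∑ j, Real.exp (z j)) := by
      rw [hα, Real.log_div (Real.exp_ne_zero _) hZ.ne', Real.log_exp]
    rw [mul_klFun_div h_pos, h_log]
    ring
  simp only [h_term, Finset.sum_add_distrib, Finset.sum_sub_distrib, ← Finset.sum_mul,
    hα_sum, ha_sum]
  ring

/-- **Variational characterization of softmax via entropy regularization.**
For a nonempty finite index set `I` and logits `z`, the softmax vector
`α m = exp (z m) / ∑ j, exp (z j)` lies in the probability simplex and is the
unique maximizer over the simplex of the entropy-regularized linear objective
`a ↦ ∑ m, a m * z m + H(a)` where `H(a) = -∑ m, a m * log (a m)`. -/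
theorem softmax_entropy_variational_characterization
    {I : Type*} [Fintype I] [Nonempty I]
    (z : I → ℝ) (α : I → ℝ)
    (hα : ∀ m, α m = Real.exp (z m) / ∑ j, Real.exp (z j)) :
    ((∀ m, 0 ≤ α m) ∧ ∑ m, α m = 1) ∧
      ∀ a : I → ℝ, (∀ m, 0 ≤ a m) → ∑ m, a m = 1 →
        ((∑ m, a m * z m) + (-∑ m, a m * Real.log (a m)) ≤
            (∑ m, α m * z m) + (-∑ m, α m * Real.log (α m))) ∧
        (((∑ m, a m * z m) + (-∑ m, a m * Real.log (a m)) =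
            (∑ m, α m * z m) + (-∑ m, α m * Real.log (α m))) ↔ a = α) := by
  have hZ : 0 < ∑ j, Real.exp (z j) :=
    Finset.sum_pos (fun _ _ => Real.exp_pos _) Finset.univ_nonempty
  have h_pos (m : I) : 0 < α m := hα m ▸ div_pos (Real.exp_pos _) hZ
  have h_sum : ∑ m, α m = 1 := by
    simp only [hα, ← Finset.sum_div]
    exact div_self hZ.ne'
  refine ⟨⟨fun m => (h_pos m).le, h_sum⟩, fun a ha ha_sum => ?_⟩
  have h_ratio (m : I) : 0 ≤ a m / α m := div_nonneg (ha m) (h_pos m).le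
  have h_term (m : I) : 0 ≤ α m * InformationTheory.klFun (a m / α m) :=
    mul_nonneg (h_pos m).le (InformationTheory.klFun_nonneg (h_ratio m))
  have h_max : (∑ m, α m * z m) + (-∑ m, α m * Real.log (α m)) =
      Real.log (∑ j, Real.exp (z j)) := by
    rw [sum_mul_add_entropy_eq_log_sum_exp_sub hα h_sum h_sum]
    simp [div_self (h_pos _).ne', InformationTheory.klFun_one]
  rw [h_max, sum_mul_add_entropy_eq_log_sum_exp_sub hα h_sum ha_sum]
  refine ⟨sub_le_self _ (Finset.sum_nonneg fun m _ => h_term m), ?_⟩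
  rw [sub_eq_self, Finset.sum_eq_zero_iff_of_nonneg fun m _ => h_term m, funext_iff]
  refine ⟨fun h m => ?_, fun h m _ => ?_⟩
  · have h_zero := (mul_eq_zero.mp (h m (Finset.mem_univ m))).resolve_left (h_pos m).ne'
    rw [InformationTheory.klFun_eq_zero_iff (h_ratio m)] at h_zero
    exact (div_eq_one_iff_eq (h_pos m).ne').mp h_zero
  · rw [h m, div_self (h_pos m).ne', InformationTheory.klFun_one, mul_zero]
end

section
/- Let I be a nonempty finite index set, ζ : I → ℝ, and let π : I → ℝ be a strictly positive probability vector on I. Define α m = π m * exp(ζ m) / (∑ j, π j * exp(ζ j)), and let m⋆ ∈ I be an index attaining the maximum of ζ over I. Then 0 ≤ (max over m ∈ I of ζ m) − ∑ m, α m * ζ m ≤ log(1 / π m⋆). -/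
/-- Gibbs inequality: the log-partition function is at most the mean logit under the softmax. -/
theorem log_sum_mul_exp_le_sum_softmax_mul {I : Type*} [Fintype I] {ζ π : I → ℝ}
    (hπsum : ∑ m, π m = 1) (hπ : ∀ m, 0 ≤ π m) (hZ : 0 < ∑ j, π j * Real.exp (ζ j)) :
    Real.log (∑ j, π j * Real.exp (ζ j)) ≤
      ∑ m, π m * Real.exp (ζ m) / (∑ j, π j * Real.exp (ζ j)) * ζ m := by
  set Z := ∑ j, π j * Real.exp (ζ j) with hZdef
  have hsum : ∑ m, π m * Real.exp (ζ m) / Z = 1 := by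
    rw [← Finset.sum_div, ← hZdef, div_self hZ.ne']
  have hterm (m : I) : π m * Real.exp (ζ m) / Z * (Real.log Z - ζ m) ≤
      π m - π m * Real.exp (ζ m) / Z := by
    have hlog : Real.log Z - ζ m ≤ Z / Real.exp (ζ m) - 1 := by
      have h := Real.log_le_sub_one_of_pos (div_pos hZ (Real.exp_pos (ζ m)))
      rwa [Real.log_div hZ.ne' (Real.exp_ne_zero _), Real.log_exp] at h
    calc π m * Real.exp (ζ m) / Z * (Real.log Z - ζ m)
        ≤ π m * Real.exp (ζ m) / Z * (Z / Real.exp (ζ m) - 1) :=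
          mul_le_mul_of_nonneg_left hlog
            (div_nonneg (mul_nonneg (hπ m) (Real.exp_pos _).le) hZ.le)
      _ = π m - π m * Real.exp (ζ m) / Z := by field_simp
  have h := Finset.sum_le_sum fun m (_ : m ∈ Finset.univ) => hterm m
  simp only [mul_sub, Finset.sum_sub_distrib, ← Finset.sum_mul, hsum, hπsum] at h
  linarith

/-- **State-prior tradeoff bound.**
For the prior-weighted softmax `α m = π m * exp (ζ m) / ∑ j, π j * exp (ζ j)` with
strictly positive probability prior `π`, and `m⋆` attaining the maximum of `ζ`,
we have `0 ≤ max ζ - ∑ m, α m * ζ m ≤ log (1 / π m⋆)`. -/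
theorem state_prior_tradeoff_bound
    {I : Type*} [Fintype I] [Nonempty I]
    (ζ π : I → ℝ) (hπpos : ∀ m, 0 < π m) (hπsum : ∑ m, π m = 1)
    (α : I → ℝ)
    (hα : ∀ m, α m = π m * Real.exp (ζ m) / ∑ j, π j * Real.exp (ζ j))
    (mstar : I) (hmax : ∀ m, ζ m ≤ ζ mstar) :
    0 ≤ ζ mstar - ∑ m, α m * ζ m ∧
      ζ mstar - ∑ m, α m * ζ m ≤ Real.log (1 / π mstar) := by
  obtain rfl : α = fun m => π m * Real.exp (ζ m) / ∑ j, π j * Real.exp (ζ j) := funext hα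
  have hpos (m : I) : 0 < π m * Real.exp (ζ m) := mul_pos (hπpos m) (Real.exp_pos _)
  have hZ : 0 < ∑ j, π j * Real.exp (ζ j) :=
    Finset.sum_pos (fun m _ => hpos m) Finset.univ_nonempty
  constructor
  · have hle : ∑ m, π m * Real.exp (ζ m) / (∑ j, π j * Real.exp (ζ j)) * ζ m ≤
        ∑ m, π m * Real.exp (ζ m) / (∑ j, π j * Real.exp (ζ j)) * ζ mstar :=
      Finset.sum_le_sum fun m _ =>
        mul_le_mul_of_nonneg_left (hmax m) (div_pos (hpos m) hZ).le
    rw [← Finset.sum_mul, ← Finset.sum_div, div_self hZ.ne', one_mul] at hle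
    exact sub_nonneg.2 hle
  · have hgibbs := log_sum_mul_exp_le_sum_softmax_mul hπsum (fun m => (hπpos m).le) hZ
    have hterm : Real.log (π mstar * Real.exp (ζ mstar)) ≤
        Real.log (∑ j, π j * Real.exp (ζ j)) :=
      Real.log_le_log (hpos mstar)
        (Finset.single_le_sum (fun m _ => (hpos m).le) (Finset.mem_univ mstar))
    rw [Real.log_mul (hπpos mstar).ne' (Real.exp_ne_zero _), Real.log_exp] at hterm
    rw [one_div, Real.log_inv]
    linarith
end

section
/- Let k ≥ 1 and let α : Fin k → ℝ satisfy α i ≥ 0 for all i and ∑ i, α i = 1. Then the symmetric matrix J = diag(α) − α αᵀ, whose entries are J i j = α i * (if i = j then 1 else 0) − α i * α j, has ℓ²→ℓ² operator norm at most 1/2; equivalently, for every v : Fin k → ℝ, ‖J.mulVec v‖₂ ≤ (1/2) * ‖v‖₂. Consequently the softmax map is 1/2-Lipschitz with respect to the Euclidean norm: for all z, z' : EuclideanSpace ℝ (Fin k), ‖softmax(z) − softmax(z')‖ ≤ (1/2) * ‖z − z'‖. -/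
/-- The `ℓ² → ℓ²` operator norm of a real matrix: the norm of the associated
linear map between Euclidean spaces. -/
noncomputable def l2OpNorm {p q : Type*} [Fintype p] [Fintype q] [DecidableEq q]
    (A : Matrix p q ℝ) : ℝ :=
  ‖LinearMap.toContinuousLinearMap (Matrix.toEuclideanLin A)‖

/-- **Schur test** for a real matrix whose absolute row and column sums are bounded. -/
theorem Matrix.sum_sq_mulVec_le_of_sum_abs_le {m n : Type*} [Fintype m] [Fintype n]
    (A : Matrix m n ℝ) {r c : ℝ} (hrow : ∀ i, ∑ j, |A i j| ≤ r)
    (hcol : ∀ j, ∑ i, |A i j| ≤ c) (hr : 0 ≤ r) (v : n → ℝ) :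
    ∑ i, (A.mulVec v) i ^ 2 ≤ r * c * ∑ j, v j ^ 2 := by
  have hi : ∀ i, (A.mulVec v) i ^ 2 ≤ r * ∑ j, |A i j| * v j ^ 2 := fun i ↦
    calc (A.mulVec v) i ^ 2
        ≤ (∑ j, |A i j|) * ∑ j, |A i j| * v j ^ 2 :=
          Finset.sum_sq_le_sum_mul_sum_of_sq_le_mul _ (fun _ _ ↦ abs_nonneg _)
            (fun _ _ ↦ by positivity) fun j _ ↦ by
            rw [← mul_assoc, abs_mul_abs_self, mul_pow, pow_two (A i j)]
      _ ≤ r * ∑ j, |A i j| * v j ^ 2 := by gcongr; exact hrow i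
  calc ∑ i, (A.mulVec v) i ^ 2
      ≤ ∑ i, r * ∑ j, |A i j| * v j ^ 2 := Finset.sum_le_sum fun i _ ↦ hi i
    _ = r * ∑ j, (∑ i, |A i j|) * v j ^ 2 := by
        rw [← Finset.mul_sum, Finset.sum_comm]
        simp only [Finset.sum_mul]
    _ ≤ r * ∑ j, c * v j ^ 2 := by gcongr with j; exact hcol j
    _ = r * c * ∑ j, v j ^ 2 := by rw [← Finset.mul_sum, mul_assoc]

section SoftmaxJacobian

variable {ι : Type*} [Fintype ι] [DecidableEq ι]

/-- The matrix `diag α - α αᵀ`, the Jacobian of softmax where its value is `α`. -/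
def softmaxJacobian (α : ι → ℝ) : Matrix ι ι ℝ :=
  Matrix.of fun i j ↦ α i * (if i = j then 1 else 0) - α i * α j

theorem softmaxJacobian_mulVec (α v : ι → ℝ) (i : ι) :
    (softmaxJacobian α).mulVec v i = α i * (v i - ∑ j, α j * v j) := by
  simp [softmaxJacobian, Matrix.mulVec, dotProduct, sub_mul, Finset.sum_sub_distrib, mul_sub,
    Finset.mul_sum, mul_assoc]

theorem sum_abs_softmaxJacobian_le {α : ι → ℝ} (hα : α ∈ stdSimplex ℝ ι) (i : ι) :
    ∑ j, |softmaxJacobian α i j| ≤ 1 / 2 := by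
  have hj : ∀ j, |softmaxJacobian α i j|
      = α i * α j + if i = j then α i - 2 * α i ^ 2 else 0 := by
    intro j
    rcases eq_or_ne i j with rfl | hij
    · have h1 : α i ≤ 1 := (mem_Icc_of_mem_stdSimplex hα i).2
      have : 0 ≤ α i * (1 - α i) := mul_nonneg (hα.1 i) (sub_nonneg.2 h1)
      simp only [softmaxJacobian, Matrix.of_apply, if_true]
      rw [abs_of_nonneg (by linarith)]
      ring
    · simp [softmaxJacobian, hij, abs_of_nonneg (hα.1 _)]
  simp only [hj, Finset.sum_add_distrib, ← Finset.mul_sum, hα.2, Finset.sum_ite_eq,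
    Finset.mem_univ, if_true]
  nlinarith [sq_nonneg (2 * α i - 1)]

theorem norm_softmaxJacobian_mulVec_le {α : ι → ℝ} (hα : α ∈ stdSimplex ℝ ι) (v : ι → ℝ) :
    ‖WithLp.toLp 2 ((softmaxJacobian α).mulVec v)‖ ≤ 1 / 2 * ‖WithLp.toLp 2 v‖ := by
  have hsymm : ∀ i j, softmaxJacobian α i j = softmaxJacobian α j i := by
    intro i j
    rcases eq_or_ne i j with rfl | hij
    · rfl
    · simp [softmaxJacobian, hij, hij.symm, mul_comm]
  have hcol : ∀ j, ∑ i, |softmaxJacobian α i j| ≤ 1 / 2 := fun j ↦ by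
    simpa only [hsymm _ j] using sum_abs_softmaxJacobian_le hα j
  refine le_of_sq_le_sq ?_ (by positivity)
  rw [mul_pow, EuclideanSpace.real_norm_sq_eq, EuclideanSpace.real_norm_sq_eq, pow_two (1 / 2 : ℝ)]
  exact Matrix.sum_sq_mulVec_le_of_sum_abs_le _ (sum_abs_softmaxJacobian_le hα) hcol
    (by norm_num) v

end SoftmaxJacobian

section Softmax

variable {ι : Type*} [Fintype ι]

/-- The softmax map `z ↦ exp z / ∑ j, exp (z j)`. -/
noncomputable def softmaxVec (z : ι → ℝ) : ι → ℝ :=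
  fun i ↦ Real.exp (z i) / ∑ j, Real.exp (z j)

theorem softmaxVec_mem_stdSimplex [Nonempty ι] (z : ι → ℝ) : softmaxVec z ∈ stdSimplex ℝ ι := by
  have hS : 0 < ∑ j, Real.exp (z j) :=
    Finset.sum_pos (fun _ _ ↦ Real.exp_pos _) Finset.univ_nonempty
  refine ⟨fun i ↦ by unfold softmaxVec; positivity, ?_⟩
  simp only [softmaxVec, ← Finset.sum_div]
  exact div_self hS.ne'

theorem hasDerivAt_softmaxVec [DecidableEq ι] {γ : ℝ → ι → ℝ} {γ' : ι → ℝ} {t : ℝ}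
    (hγ : HasDerivAt γ γ' t) :
    HasDerivAt (fun s ↦ softmaxVec (γ s))
      ((softmaxJacobian (softmaxVec (γ t))).mulVec γ') t := by
  rw [hasDerivAt_pi] at hγ ⊢
  intro i
  have hS : ∑ j, Real.exp (γ t j) ≠ 0 :=
    (Finset.sum_pos (fun _ _ ↦ Real.exp_pos _) ⟨i, Finset.mem_univ i⟩).ne'
  refine ((hγ i).exp.fun_div
    (HasDerivAt.fun_sum fun j (_ : j ∈ Finset.univ) ↦ (hγ j).exp) hS).congr_deriv ?_
  rw [softmaxJacobian_mulVec]
  simp only [softmaxVec, div_mul_eq_mul_div, ← Finset.sum_div]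
  field_simp

theorem norm_softmaxVec_sub_le [Nonempty ι] (x y : ι → ℝ) :
    ‖WithLp.toLp 2 (softmaxVec x - softmaxVec y)‖ ≤ 1 / 2 * ‖WithLp.toLp 2 (x - y)‖ := by
  classical
  have hline : ∀ t : ℝ, HasDerivAt (fun s : ℝ ↦ y + s • (x - y)) (x - y) t := fun t ↦ by
    simpa using ((hasDerivAt_id t).smul_const (x - y)).const_add y
  have hderiv := fun t ↦
    (EuclideanSpace.equiv ι ℝ).symm.toContinuousLinearMap.hasFDerivAt.comp_hasDerivAt t
      (hasDerivAt_softmaxVec (hline t))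
  have := norm_image_sub_le_of_norm_deriv_le_segment_01'
    (fun t _ ↦ (hderiv t).hasDerivWithinAt)
    (fun t _ ↦ norm_softmaxJacobian_mulVec_le (softmaxVec_mem_stdSimplex _) (x - y))
  simpa using this

end Softmax

/-- **Softmax Jacobian bound and 1/2-Lipschitzness of softmax.**
For a probability vector `α`, the matrix `J = diag α - α αᵀ` has `ℓ²→ℓ²` operator
norm at most `1/2` (equivalently `‖J.mulVec v‖₂ ≤ (1/2) ‖v‖₂` for all `v`), and
consequently the softmax map is `1/2`-Lipschitz in the Euclidean norm. -/
theorem softmax_jacobian_norm_le_half_and_softmax_lipschitz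
    {k : ℕ} (hk : 1 ≤ k) (α : Fin k → ℝ)
    (hα0 : ∀ i, 0 ≤ α i) (hα1 : ∑ i, α i = 1)
    (J : Matrix (Fin k) (Fin k) ℝ)
    (hJ : ∀ i j, J i j = α i * (if i = j then 1 else 0) - α i * α j) :
    l2OpNorm J ≤ 1 / 2 ∧
    (∀ v : Fin k → ℝ,
      ‖(EuclideanSpace.equiv (Fin k) ℝ).symm (J.mulVec v)‖ ≤
        (1 / 2) * ‖(EuclideanSpace.equiv (Fin k) ℝ).symm v‖) ∧
    (∀ softmax : EuclideanSpace ℝ (Fin k) → EuclideanSpace ℝ (Fin k),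
      (∀ z i, softmax z i = Real.exp (z i) / ∑ j, Real.exp (z j)) →
      ∀ z z' : EuclideanSpace ℝ (Fin k),
        ‖softmax z - softmax z'‖ ≤ (1 / 2) * ‖z - z'‖) := by
  have : Nonempty (Fin k) := ⟨⟨0, hk⟩⟩
  obtain rfl : J = softmaxJacobian α := Matrix.ext hJ
  have hbound := norm_softmaxJacobian_mulVec_le (α := α) ⟨hα0, hα1⟩
  refine ⟨ContinuousLinearMap.opNorm_le_bound _ (by norm_num) fun v ↦ hbound v.ofLp,
    hbound, fun softmax hsoftmax z z' ↦ ?_⟩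
  have hvec : ∀ z, softmax z = WithLp.toLp 2 (softmaxVec z.ofLp) := fun z ↦
    PiLp.ext fun i ↦ hsoftmax z i
  rw [hvec, hvec]
  exact norm_softmaxVec_sub_le z.ofLp z'.ofLp
end
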